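/- Assume |Res F| = 1, i.e. there exist A₁,…,A_d ∈ ℂ² ∖ {(0,0)} with F₀(Z) = ∏_{i=1}^d (Z ∧ A_i) for all Z ∈ ℂ² and ∏_{i=1}^d |F₁(A_i)| = 1. Suppose q₁,…,q_{d+1} ∈ ℂ² ∖ {(0,0)} satisfy F(Z) ∧ Z = ∏_{j=1}^{d+1} (Z ∧ q_j) for all Z ∈ ℂ². Then ∑_{j=1}^{d+1} G^F(q_j) = 0. -/

import Mathlib

open Filter Finset MvPolynomial

/-- Evaluation of a bivariate polynomial at a point of `ℂ²`. -/
noncomputable def ev (P : MvPolynomial (Fin 2) ℂ) (Z : ℂ × ℂ) : ℂ :=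
  MvPolynomial.eval ![Z.1, Z.2] P

/-- The self-map of `ℂ²` determined by the pair `F = (F₀, F₁)`. -/
noncomputable def Fmap (F₀ F₁ : MvPolynomial (Fin 2) ℂ) (Z : ℂ × ℂ) : ℂ × ℂ :=
  (ev F₀ Z, ev F₁ Z)

/-- The Euclidean norm on `ℂ²`. -/
noncomputable def enorm2 (Z : ℂ × ℂ) : ℝ := Real.sqrt (‖Z.1‖ ^ 2 + ‖Z.2‖ ^ 2)

/-- The wedge `Z ∧ W = Z₀W₁ − Z₁W₀` on `ℂ²`. -/
def wedge (Z W : ℂ × ℂ) : ℂ := Z.1 * W.2 - Z.2 * W.1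

lemma natDegree_dehom {d : ℕ} {P : MvPolynomial (Fin 2) ℂ} (h : P.IsHomogeneous d) :
    (MvPolynomial.aeval ![(Polynomial.X : Polynomial ℂ), 1] P).natDegree ≤ d := by
  rw [P.as_sum, map_sum]
  apply Polynomial.natDegree_sum_le_of_forall_le
  intro m hm
  have hm' := h (MvPolynomial.mem_support_iff.1 hm)
  rw [MvPolynomial.aeval_monomial]
  have h2 : m 0 ≤ d := by
    rw [← hm']
    simp [Finsupp.weight_apply, Finsupp.sum_fintype]
  simp only [Finsupp.prod_fintype _ _ (fun i => pow_zero _), Fin.prod_univ_two]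
  simp only [Matrix.cons_val_zero, Matrix.cons_val_one, one_pow, mul_one]
  exact (Polynomial.natDegree_C_mul_X_pow_le _ _).trans h2

lemma hom_factor (d : ℕ) : ∀ p : Polynomial ℂ, p.natDegree ≤ d →
    ∃ (c : ℂ) (B : Fin d → ℂ × ℂ), ∀ Z, ev (p.homogenize d) Z = c * ∏ i, wedge Z (B i) := by
  induction d with
  | zero =>
    intro p hp
    obtain ⟨c, rfl⟩ := Polynomial.natDegree_eq_zero.1 (Nat.le_zero.1 hp)
    exact ⟨c, fun _ => 0, fun Z => by simp [ev]⟩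
  | succ d ih =>
    intro p hp
    by_cases hpd : p.natDegree ≤ d
    · obtain ⟨c, B, hB⟩ := ih p hpd
      refine ⟨c, Fin.cons (-1, 0) B, fun Z => ?_⟩
      have := Polynomial.homogenize_mul (1 : Polynomial ℂ) p (m := 1) (n := d) (by simp) hpd
      rw [one_mul, add_comm 1 d] at this
      rw [this, Fin.prod_univ_succ]
      have h3 := hB Z
      simp only [ev] at h3
      simp only [ev, map_mul, h3, Fin.cons_zero, Fin.cons_succ]
      simp [wedge]
      ring
    · have hdeg : p.degree ≠ 0 := by
        intro h0
        apply hpd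
        rw [Polynomial.natDegree_eq_of_degree_eq_some (n := 0) (by simpa using h0)]
        exact Nat.zero_le d
      obtain ⟨r, hr⟩ := IsAlgClosed.exists_root p hdeg
      obtain ⟨p', rfl⟩ := Polynomial.dvd_iff_isRoot.2 hr
      have hp0 : p' ≠ 0 := by
        rintro rfl
        simp at hpd
      have hp' : p'.natDegree ≤ d := by
        rw [Polynomial.natDegree_mul (Polynomial.X_sub_C_ne_zero r) hp0,
          Polynomial.natDegree_X_sub_C] at hp
        omega
      obtain ⟨c, B, hB⟩ := ih p' hp'
      refine ⟨c, Fin.cons (r, 1) B, fun Z => ?_⟩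
      have := Polynomial.homogenize_mul (Polynomial.X - Polynomial.C r) p' (m := 1) (n := d)
        (by simp) hp'
      rw [add_comm 1 d] at this
      rw [this, Fin.prod_univ_succ]
      have h3 := hB Z
      simp only [ev] at h3
      simp only [ev, map_mul, h3, Fin.cons_zero, Fin.cons_succ]
      simp [wedge]
      ring

lemma wedge_factor {d : ℕ} (hd : 2 ≤ d) {P : MvPolynomial (Fin 2) ℂ} (h : P.IsHomogeneous d) :
    ∃ B : Fin d → ℂ × ℂ, ∀ Z, ev P Z = ∏ i, wedge Z (B i) := by
  obtain ⟨c, B, hB⟩ := hom_factor d _ (natDegree_dehom h)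
  rw [Polynomial.homogenize_eq_of_isHomogeneous h rfl] at hB
  obtain ⟨m, rfl⟩ : ∃ m, d = m + 1 := ⟨d - 1, by omega⟩
  refine ⟨Fin.cons (c * (B 0).1, c * (B 0).2) (fun i => B i.succ), fun Z => ?_⟩
  rw [hB, Fin.prod_univ_succ, Fin.prod_univ_succ]
  simp only [Fin.cons_zero, Fin.cons_succ, wedge]
  ring

lemma ev_smul {d : ℕ} (hd : 2 ≤ d) {P : MvPolynomial (Fin 2) ℂ} (h : P.IsHomogeneous d)
    (c : ℂ) (Z : ℂ × ℂ) : ev P (c • Z) = c ^ d * ev P Z := by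
  obtain ⟨B, hB⟩ := wedge_factor hd h
  have : ∀ i, wedge (c • Z) (B i) = c * wedge Z (B i) := by
    intro i; simp [wedge]; ring
  simp [hB, this, Finset.prod_mul_distrib]

lemma norm_wedge_comm (Z W : ℂ × ℂ) : ‖wedge Z W‖ = ‖wedge W Z‖ := by
  rw [← norm_neg]; congr 1; simp only [wedge]; ring

/-- Reciprocity for products of wedges. -/
lemma recip {m n : ℕ} {f g : ℂ × ℂ → ℂ} (a : Fin m → ℂ × ℂ) (b : Fin n → ℂ × ℂ)
    (hf : ∀ Z, f Z = ∏ i, wedge Z (a i)) (hg : ∀ Z, g Z = ∏ i, wedge Z (b i)) :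
    ∏ j, ‖f (b j)‖ = ∏ i, ‖g (a i)‖ := by
  simp only [hf, hg, norm_prod]
  rw [Finset.prod_comm]
  refine Finset.prod_congr rfl fun i _ => Finset.prod_congr rfl fun j _ => norm_wedge_comm _ _

lemma enorm2_pos {Z : ℂ × ℂ} (h : Z ≠ 0) : 0 < enorm2 Z := by
  unfold enorm2
  apply Real.sqrt_pos.2
  by_contra hc
  apply h
  have h1 : ‖Z.1‖ ^ 2 = 0 := by nlinarith [sq_nonneg ‖Z.1‖, sq_nonneg ‖Z.2‖]
  have h2 : ‖Z.2‖ ^ 2 = 0 := by nlinarith [sq_nonneg ‖Z.1‖, sq_nonneg ‖Z.2‖]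
  ext
  · simpa using h1
  · simpa using h2

lemma enorm2_smul (c : ℂ) (Z : ℂ × ℂ) : enorm2 (c • Z) = ‖c‖ * enorm2 Z := by
  unfold enorm2
  rw [← Real.sqrt_sq (norm_nonneg c), ← Real.sqrt_mul (sq_nonneg _)]
  congr 1
  simp
  ring

lemma exists_eigen {Z W : ℂ × ℂ} (hZ : Z ≠ 0) (h : wedge W Z = 0) : ∃ c : ℂ, W = c • Z := by
  simp only [wedge] at h
  by_cases h1 : Z.1 = 0
  · have h2 : Z.2 ≠ 0 := fun h2 => hZ (Prod.ext h1 h2)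
    refine ⟨W.2 / Z.2, Prod.ext ?_ ?_⟩
    · simp only [Prod.smul_fst, smul_eq_mul, h1, mul_zero]
      simpa [h1, h2] using h
    · simp only [Prod.smul_snd, smul_eq_mul]; field_simp
  · refine ⟨W.1 / Z.1, Prod.ext ?_ ?_⟩
    · simp only [Prod.smul_fst, smul_eq_mul]; field_simp
    · simp only [Prod.smul_snd, smul_eq_mul]; field_simp; linear_combination -h

/-- Assume `|Res F| = 1` (witnessed by a factorization
`F₀(Z) = ∏ᵢ (Z ∧ Aᵢ)` with `∏ᵢ |F₁(Aᵢ)| = 1`).  If `q₁, …, q_{d+1} ∈ ℂ² ∖ {0}` satisfy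
`F(Z) ∧ Z = ∏ⱼ (Z ∧ qⱼ)` for all `Z`, then `∑ⱼ G^F(qⱼ) = 0`. -/
theorem stmt9 (d : ℕ) (hd : 2 ≤ d) (F₀ F₁ : MvPolynomial (Fin 2) ℂ)
    (h₀ : F₀.IsHomogeneous d) (h₁ : F₁.IsHomogeneous d)
    (hcz : ∀ Z : ℂ × ℂ, ev F₀ Z = 0 → ev F₁ Z = 0 → Z = 0)
    (G : ℂ × ℂ → ℝ)
    (hG : ∀ Z : ℂ × ℂ, Z ≠ 0 → Tendsto
      (fun n : ℕ => Real.log (enorm2 ((Fmap F₀ F₁)^[n] Z)) / (d : ℝ) ^ n)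
      atTop (nhds (G Z)))
    (A : Fin d → ℂ × ℂ) (hA : ∀ i, A i ≠ 0)
    (hfac : ∀ Z : ℂ × ℂ, ev F₀ Z = ∏ i, wedge Z (A i))
    (hres : ∏ i, ‖ev F₁ (A i)‖ = 1)
    (q : Fin (d + 1) → ℂ × ℂ) (hq : ∀ j, q j ≠ 0)
    (hfix : ∀ Z : ℂ × ℂ, wedge (Fmap F₀ F₁ Z) Z = ∏ j, wedge Z (q j)) :
    ∑ j, G (q j) = 0 := by
  classical
  have hd1 : (1 : ℝ) < d := by exact_mod_cast (by omega : 1 < d)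
  -- eigenvalues
  have hw : ∀ j, wedge (Fmap F₀ F₁ (q j)) (q j) = 0 := by
    intro j
    rw [hfix]
    exact Finset.prod_eq_zero (Finset.mem_univ j) (by simp only [wedge]; ring)
  choose l hl using fun j => exists_eigen (hq j) (hw j)
  have hne : ∀ Z : ℂ × ℂ, Z ≠ 0 → Fmap F₀ F₁ Z ≠ 0 := by
    intro Z hZ h
    exact hZ (hcz Z (congrArg Prod.fst h) (congrArg Prod.snd h))
  have hl0 : ∀ j, l j ≠ 0 := by
    intro j h
    apply hne _ (hq j)
    rw [hl, h, zero_smul]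
  have hsm : ∀ (c : ℂ) Z, Fmap F₀ F₁ (c • Z) = c ^ d • Fmap F₀ F₁ Z := by
    intro c Z
    simp only [Fmap, ev_smul hd h₀, ev_smul hd h₁]
    rfl
  have hit : ∀ (n : ℕ) (c : ℂ) Z, (Fmap F₀ F₁)^[n] (c • Z) = c ^ d ^ n • (Fmap F₀ F₁)^[n] Z := by
    intro n
    induction n with
    | zero => intro c Z; simp
    | succ n ih =>
      intro c Z
      rw [Function.iterate_succ_apply', ih, hsm, Function.iterate_succ_apply', ← pow_mul, pow_succ]
  have hitne : ∀ (n : ℕ) Z, Z ≠ 0 → (Fmap F₀ F₁)^[n] Z ≠ 0 := by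
    intro n Z hZ
    induction n with
    | zero => simpa using hZ
    | succ n ih => rw [Function.iterate_succ_apply']; exact hne _ ih
  have hGl : ∀ j, G (q j) = Real.log ‖l j‖ / (d - 1) := by
    intro j
    have t1 := (hG _ (hq j)).comp (tendsto_add_atTop_nat 1)
    have t2 := ((hG _ (hq j)).const_add (Real.log ‖l j‖)).div_const (d : ℝ)
    have heq : G (q j) = (Real.log ‖l j‖ + G (q j)) / d := by
      refine tendsto_nhds_unique t1 (t2.congr fun n => ?_)
      simp only [Function.comp]
      rw [Function.iterate_succ_apply, hl, hit, enorm2_smul, norm_pow,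
        Real.log_mul (pow_ne_zero _ (norm_ne_zero_iff.2 (hl0 j)))
          (enorm2_pos (hitne n _ (hq j))).ne', Real.log_pow]
      have : (d : ℝ) ≠ 0 := by linarith
      push_cast
      field_simp
      ring
    have : (d : ℝ) ≠ 0 := by linarith
    have : (d : ℝ) - 1 ≠ 0 := by linarith
    field_simp at heq ⊢
    linarith
  suffices hprod : ∏ j, ‖l j‖ = 1 by
    simp only [hGl]
    rw [← Finset.sum_div, ← Real.log_prod (fun j _ => norm_ne_zero_iff.2 (hl0 j)), hprod]
    simp
  -- choose a generic linear form
  obtain ⟨t, ht⟩ : ∃ t : ℂ, ∀ j, (q j).1 + t * (q j).2 ≠ 0 := by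
    obtain ⟨t, ht⟩ := Infinite.exists_notMem_finset
      (Finset.univ.image fun j => -(q j).1 / (q j).2)
    refine ⟨t, fun j h => ?_⟩
    by_cases h2 : (q j).2 = 0
    · exact hq j (Prod.ext (by simpa [h2] using h) h2)
    · apply ht
      refine Finset.mem_image.2 ⟨j, Finset.mem_univ _, ?_⟩
      field_simp
      linear_combination -h
  have hH : (F₀ + MvPolynomial.C t * F₁).IsHomogeneous d := by
    refine h₀.add ?_
    simpa using (MvPolynomial.isHomogeneous_C (Fin 2) t).mul h₁
  have hev : ∀ Z, ev (F₀ + MvPolynomial.C t * F₁) Z = ev F₀ Z + t * ev F₁ Z := by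
    intro Z; simp [ev]
  obtain ⟨B, hB⟩ := wedge_factor hd hH
  obtain ⟨D, hD⟩ := wedge_factor hd h₁
  have hzero : ∀ {n : ℕ} (a : Fin n → ℂ × ℂ) (k : Fin n), ∏ i, wedge (a k) (a i) = 0 := by
    intro n a k
    exact Finset.prod_eq_zero (Finset.mem_univ k) (by simp only [wedge]; ring)
  have hresB : ∏ i, ‖ev F₁ (B i)‖ = 1 := by
    rw [← recip B D hB hD, ← hres, ← recip A D hfac hD]
    refine Finset.prod_congr rfl fun k _ => ?_
    have : ev F₁ (D k) = 0 := by rw [hD, hzero]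
    rw [hev, this, mul_zero, add_zero]
  have e1 := recip B q hB hfix
  have e2 : ∀ j, ‖ev (F₀ + MvPolynomial.C t * F₁) (q j)‖ = ‖l j‖ * ‖(q j).1 + t * (q j).2‖ := by
    intro j
    have a1 : ev F₀ (q j) = l j * (q j).1 := congrArg Prod.fst (hl j)
    have a2 : ev F₁ (q j) = l j * (q j).2 := congrArg Prod.snd (hl j)
    rw [hev, a1, a2, ← norm_mul]
    congr 1; ring
  have e3 : ∀ i, ‖wedge (Fmap F₀ F₁ (B i)) (B i)‖ = ‖ev F₁ (B i)‖ * ‖(B i).1 + t * (B i).2‖ := by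
    intro i
    have : ev F₀ (B i) + t * ev F₁ (B i) = 0 := by rw [← hev, hB, hzero]
    rw [← norm_mul, ← norm_neg]
    congr 1
    simp only [wedge, Fmap]
    linear_combination -(B i).2 * this
  have e4 : ∏ i, ‖(B i).1 + t * (B i).2‖ = ∏ j, ‖(q j).1 + t * (q j).2‖ := by
    have hw' : ∀ Z : ℂ × ℂ, ‖Z.1 + t * Z.2‖ = ‖wedge (-t, 1) Z‖ := by
      intro Z
      rw [← norm_neg]; congr 1; simp only [wedge]; ring
    simp only [hw', ← norm_prod]
    rw [← hB, ← hfix, hev]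
    congr 1
    simp only [wedge, Fmap]
    ring
  simp only [e2, e3, Finset.prod_mul_distrib, hresB, e4, one_mul] at e1
  have hq0 : ∏ j, ‖(q j).1 + t * (q j).2‖ ≠ 0 :=
    Finset.prod_ne_zero_iff.2 fun j _ => norm_ne_zero_iff.2 (ht j)
  exact mul_right_cancel₀ hq0 (by rw [e1, one_mul])
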